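/- arXiv:1307.4197 — 2 statements merged into one kernel-verified Lean document; each statement's English description precedes it below -/
import Mathlib

section
/- Let S be a Steiner system S(5,8,24) on a 24-element set Ω, let ∞, 0, 1 ∈ Ω be distinct points, let K₀ ∈ S be an octad with 0 ∈ K₀ and ∞ ∉ K₀, 1 ∉ K₀, and let F = {K ∈ S : ∞ ∈ K, 0 ∈ K, 1 ∉ K, |K ∩ K₀| = 4}. Then for every octad K ∈ S with ∞, 0, 1 ∈ K and |K ∩ K₀| = 4, exactly 4 members K' of F satisfy |K ∩ K'| = 2, and the remaining 24 members of F satisfy |K ∩ K'| = 4. -/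
/-- A Steiner system `S(5,8,24)`: `Ω` has 24 elements, every block (octad) has 8
elements, and every 5-element subset of `Ω` is contained in exactly one octad. -/
def IsSteinerSystem_5_8_24 {Ω : Type*} [Fintype Ω] [DecidableEq Ω]
    (S : Finset (Finset Ω)) : Prop :=
  Fintype.card Ω = 24 ∧
  (∀ K ∈ S, K.card = 8) ∧
  ∀ A : Finset Ω, A.card = 5 → ∃! K, K ∈ S ∧ A ⊆ K

open Finset

theorem Finset.sum_choose_card_inter {Ω : Type*} [DecidableEq Ω]
    (P : Finset (Finset Ω)) (B : Finset Ω) (j m : ℕ)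
    (h : ∀ T ⊆ B, #T = j → #{K ∈ P | T ⊆ K} = m) :
    ∑ K ∈ P, (#(K ∩ B)).choose j = (#B).choose j * m := by
  have key := Finset.sum_card_bipartiteAbove_eq_sum_card_bipartiteBelow
    (s := P) (t := B.powersetCard j) (fun K T => T ⊆ K)
  have hl : ∀ K ∈ P, #((B.powersetCard j).bipartiteAbove (fun K T => T ⊆ K) K)
      = (#(K ∩ B)).choose j := by
    intro K _
    rw [← card_powersetCard]
    congr 1
    ext T
    simp only [bipartiteAbove, mem_filter, mem_powersetCard, subset_inter_iff]
    tauto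
  have hr : ∀ T ∈ B.powersetCard j, #(P.bipartiteBelow (fun K T => T ⊆ K) T) = m := by
    intro T hT
    rw [mem_powersetCard] at hT
    exact h T hT.1 hT.2
  rw [sum_congr rfl hl, sum_congr rfl hr] at key
  simpa using key

theorem Finset.sum_card_inter_of_forall_card_filter_mem {Ω : Type*} [DecidableEq Ω]
    (P : Finset (Finset Ω)) (B : Finset Ω) (m : ℕ)
    (h : ∀ b ∈ B, #{K ∈ P | b ∈ K} = m) :
    ∑ K ∈ P, #(K ∩ B) = #B * m := by
  rw [← Finset.sum_card_inter h]
  exact sum_congr rfl fun K _ => by rw [inter_comm]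

/-- If every member of `P` meets `B` in `a` or `a + 2` points and every point of `B` lies in
exactly `m` members of `P`, then the number of members of each kind is determined. -/
theorem Finset.card_filter_of_two_intersection_sizes {Ω : Type*} [DecidableEq Ω]
    (P : Finset (Finset Ω)) (B : Finset Ω) (a m : ℕ)
    (h : ∀ b ∈ B, #{K ∈ P | b ∈ K} = m)
    (ha : ∀ K ∈ P, #(K ∩ B) = a ∨ #(K ∩ B) = a + 2) :
    #{K ∈ P | #(K ∩ B) = a} + #{K ∈ P | #(K ∩ B) = a + 2} = #P ∧
    a * #P + 2 * #{K ∈ P | #(K ∩ B) = a + 2} = #B * m := by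
  constructor
  · rw [← card_filter_add_card_filter_not (s := P) (fun K => #(K ∩ B) = a)]
    congr 2
    exact filter_congr fun K hK => by have := ha K hK; omega
  · rw [← sum_card_inter_of_forall_card_filter_mem P B m h, mul_comm a, mul_comm 2,
      card_filter, sum_mul, ← smul_eq_mul, ← sum_const, ← sum_add_distrib]
    refine sum_congr rfl fun K hK => ?_
    rcases ha K hK with h | h <;> simp [h]

theorem Finset.card_filter_subset_filter_mem {Ω : Type*} [DecidableEq Ω]
    (S : Finset (Finset Ω)) (A : Finset Ω) (b : Ω) :
    #{L ∈ {L ∈ S | A ⊆ L} | b ∈ L} = #{L ∈ S | insert b A ⊆ L} := by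
  rw [filter_filter]
  congr 1
  exact filter_congr fun L _ => by rw [insert_subset_iff, and_comm]

theorem Finset.card_inter_eq_card_inter_sdiff_add {Ω : Type*} [DecidableEq Ω]
    {K L C : Finset Ω} (hK : C ⊆ K) (hL : C ⊆ L) :
    (L ∩ K).card = (L ∩ (K \ C)).card + C.card := by
  rw [← Finset.inter_sdiff_assoc, Finset.card_sdiff_add_card_eq_card]
  exact Finset.subset_inter hL hK

namespace IsSteinerSystem_5_8_24

variable {Ω : Type*} [Fintype Ω] [DecidableEq Ω] {S : Finset (Finset Ω)}

theorem card_filter_subset_five (hS : IsSteinerSystem_5_8_24 S) {A : Finset Ω} (hA : #A = 5) :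
    #{K ∈ S | A ⊆ K} = 1 := by
  obtain ⟨K, hK, hu⟩ := hS.2.2 A hA
  rw [card_eq_one]
  refine ⟨K, ?_⟩
  ext L
  simp only [mem_filter, mem_singleton]
  exact ⟨hu L, fun h => h ▸ hK⟩

theorem card_filter_subset_step (hS : IsSteinerSystem_5_8_24 S) {j m : ℕ}
    (h : ∀ A : Finset Ω, #A = j + 1 → #{K ∈ S | A ⊆ K} = m) {A : Finset Ω} (hA : #A = j) :
    #{K ∈ S | A ⊆ K} * (8 - j) = (24 - j) * m := by
  have key := sum_card_inter_of_forall_card_filter_mem {K ∈ S | A ⊆ K} Aᶜ m (by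
    intro b hb
    rw [filter_filter, ← h (insert b A) (by rw [card_insert_of_notMem (by simpa using hb), hA])]
    congr 1
    exact filter_congr fun K _ => by rw [insert_subset_iff, and_comm])
  rw [card_compl, hS.1, hA] at key
  rw [← key, ← smul_eq_mul, ← sum_const]
  refine sum_congr rfl fun K hK => ?_
  rw [mem_filter] at hK
  rw [← sdiff_eq_inter_compl, card_sdiff_of_subset hK.2, hS.2.1 K hK.1, hA]

theorem card_filter_subset_four (hS : IsSteinerSystem_5_8_24 S) {A : Finset Ω} (hA : #A = 4) :
    #{K ∈ S | A ⊆ K} = 5 := by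
  have := hS.card_filter_subset_step (fun _ => hS.card_filter_subset_five) hA
  omega

theorem card_filter_subset_three (hS : IsSteinerSystem_5_8_24 S) {A : Finset Ω} (hA : #A = 3) :
    #{K ∈ S | A ⊆ K} = 21 := by
  have := hS.card_filter_subset_step (fun _ => hS.card_filter_subset_four) hA
  omega

theorem card_filter_subset_two (hS : IsSteinerSystem_5_8_24 S) {A : Finset Ω} (hA : #A = 2) :
    #{K ∈ S | A ⊆ K} = 77 := by
  have := hS.card_filter_subset_step (fun _ => hS.card_filter_subset_three) hA
  omega

theorem card_filter_subset_one (hS : IsSteinerSystem_5_8_24 S) {A : Finset Ω} (hA : #A = 1) :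
    #{K ∈ S | A ⊆ K} = 253 := by
  have := hS.card_filter_subset_step (fun _ => hS.card_filter_subset_two) hA
  omega

theorem card_inter_le_four (hS : IsSteinerSystem_5_8_24 S) {K L : Finset Ω} (hK : K ∈ S)
    (hL : L ∈ S) (hne : L ≠ K) : #(L ∩ K) ≤ 4 := by
  by_contra! hc
  obtain ⟨A, hA, hA5⟩ := exists_subset_card_eq (s := L ∩ K) (n := 5) hc
  rw [subset_inter_iff] at hA
  exact hne ((hS.2.2 A hA5).unique ⟨hL, hA.1⟩ ⟨hK, hA.2⟩)

theorem sum_choose_card_inter_erase (hS : IsSteinerSystem_5_8_24 S) {K : Finset Ω} (hK : K ∈ S)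
    {j m : ℕ} (h : ∀ A : Finset Ω, #A = j → #{L ∈ S | A ⊆ L} = m) :
    ∑ L ∈ S.erase K, (#(L ∩ K)).choose j = Nat.choose 8 j * (m - 1) := by
  rw [← hS.2.1 K hK]
  refine sum_choose_card_inter _ _ _ _ fun T hT hj => ?_
  rw [filter_erase, card_erase_of_mem (by simp [hK, hT]), h T hj]

/-- Two distinct octads meet in `0`, `2` or `4` points. -/
theorem card_inter_eq (hS : IsSteinerSystem_5_8_24 S) {K L : Finset Ω} (hK : K ∈ S)
    (hL : L ∈ S) (hne : L ≠ K) : #(L ∩ K) = 0 ∨ #(L ∩ K) = 2 ∨ #(L ∩ K) = 4 := by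
  have h1 := hS.sum_choose_card_inter_erase hK fun _ => hS.card_filter_subset_one
  have h2 := hS.sum_choose_card_inter_erase hK fun _ => hS.card_filter_subset_two
  have h3 := hS.sum_choose_card_inter_erase hK fun _ => hS.card_filter_subset_three
  have h4 := hS.sum_choose_card_inter_erase hK fun _ => hS.card_filter_subset_four
  -- On `0, …, 4`, the combination `C(i,1) - 2 C(i,2) + 4 C(i,3) - 8 C(i,4)` is the indicator
  -- function of the odd numbers.
  have hsum : ∑ L ∈ S.erase K, (((#(L ∩ K)).choose 1 : ℤ) - 2 * (#(L ∩ K)).choose 2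
      + 4 * (#(L ∩ K)).choose 3 - 8 * (#(L ∩ K)).choose 4) = 0 := by
    zify at h1 h2 h3 h4
    rw [sum_sub_distrib, sum_add_distrib, sum_sub_distrib, ← mul_sum, ← mul_sum, ← mul_sum,
      h1, h2, h3, h4]
    norm_num [Nat.choose]
  have hnn : ∀ L ∈ S.erase K, (0 : ℤ) ≤ ((#(L ∩ K)).choose 1 : ℤ) - 2 * (#(L ∩ K)).choose 2
      + 4 * (#(L ∩ K)).choose 3 - 8 * (#(L ∩ K)).choose 4 := by
    intro L hL
    rw [mem_erase] at hL
    have := hS.card_inter_le_four hK hL.2 hL.1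
    generalize #(L ∩ K) = i at this
    interval_cases i <;> simp [Nat.choose]
  have h0 := (sum_eq_zero_iff_of_nonneg hnn).1 hsum L (mem_erase.2 ⟨hne, hL⟩)
  have := hS.card_inter_le_four hK hL hne
  generalize #(L ∩ K) = i at this h0
  interval_cases i <;> simp [Nat.choose] at h0 ⊢

/-- A family `P` of octads whose members meet the octad `K` in `c > 0` points outside `B` and
cover the points of `B` uniformly is split in a determined way by the intersection size with
`K`. -/
theorem card_filter_card_inter_eq (hS : IsSteinerSystem_5_8_24 S) {K : Finset Ω} (hK : K ∈ S)
    {P : Finset (Finset Ω)} (hPS : P ⊆ S) (hKP : K ∉ P) {B : Finset Ω} {c m : ℕ}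
    (hc0 : 0 < c) (hc2 : c ≤ 2) (hB : ∀ L ∈ P, #(L ∩ K) = #(L ∩ B) + c)
    (h : ∀ b ∈ B, #{L ∈ P | b ∈ L} = m) :
    #{L ∈ P | #(L ∩ K) = 2} + #{L ∈ P | #(L ∩ K) = 4} = #P ∧
    (2 - c) * #P + 2 * #{L ∈ P | #(L ∩ K) = 4} = #B * m := by
  have key := card_filter_of_two_intersection_sizes P B (2 - c) m h (fun L hL => by
    have h1 := hS.card_inter_eq hK (hPS hL) (fun e => hKP (e ▸ hL))
    have h2 := hB L hL
    omega)
  have e2 : {L ∈ P | #(L ∩ B) = 2 - c} = {L ∈ P | #(L ∩ K) = 2} :=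
    filter_congr fun L hL => by have := hB L hL; omega
  have e4 : {L ∈ P | #(L ∩ B) = 2 - c + 2} = {L ∈ P | #(L ∩ K) = 4} :=
    filter_congr fun L hL => by have := hB L hL; omega
  rwa [e2, e4] at key

/-- `28` octads through two points `pinf ∉ K₀`, `p0 ∈ K₀` but not through `p1 ∉ K₀` meet the
octad `K₀` in four points. -/
theorem card_filter_mem_mem_notMem (hS : IsSteinerSystem_5_8_24 S) {pinf p0 p1 : Ω}
    (h01 : p0 ≠ p1) (hinf0 : pinf ≠ p0) (hinf1 : pinf ≠ p1) {K₀ : Finset Ω} (hK₀S : K₀ ∈ S)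
    (h0K : p0 ∈ K₀) (hinfK : pinf ∉ K₀) (h1K : p1 ∉ K₀) :
    #{K ∈ S | pinf ∈ K ∧ p0 ∈ K ∧ p1 ∉ K ∧ #(K ∩ K₀) = 4} = 28 := by
  have cA : #({pinf, p0} : Finset Ω) = 2 := card_pair hinf0
  have cA1 : #({p1, pinf, p0} : Finset Ω) = 3 := by
    rw [card_insert_of_notMem (by simp [hinf1.symm, h01.symm]), cA]
  have n35 := hS.card_filter_card_inter_eq hK₀S (P := {L ∈ S | {pinf, p0} ⊆ L}) (m := 21)
    (B := K₀ \ {p0}) (c := 1) (filter_subset _ _) (by simp [insert_subset_iff, hinfK])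
    (by norm_num) (by norm_num)
    (fun L hL => by
      simp only [mem_filter, insert_subset_iff, singleton_subset_iff] at hL
      exact card_inter_eq_card_inter_sdiff_add (by simpa using h0K) (by simpa using hL.2.2))
    (fun b hb => by
      simp only [mem_sdiff, mem_singleton] at hb
      rw [card_filter_subset_filter_mem]
      refine hS.card_filter_subset_three ?_
      rw [card_insert_of_notMem, cA]
      simp only [mem_insert, mem_singleton]
      rintro (rfl | rfl)
      exacts [hinfK hb.1, hb.2 rfl])
  have n7 := hS.card_filter_card_inter_eq hK₀S (P := {L ∈ S | {p1, pinf, p0} ⊆ L}) (m := 5)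
    (B := K₀ \ {p0}) (c := 1) (filter_subset _ _) (by simp [insert_subset_iff, hinfK])
    (by norm_num) (by norm_num)
    (fun L hL => by
      simp only [mem_filter, insert_subset_iff, singleton_subset_iff] at hL
      exact card_inter_eq_card_inter_sdiff_add (by simpa using h0K) (by simpa using hL.2.2.2))
    (fun b hb => by
      simp only [mem_sdiff, mem_singleton] at hb
      rw [card_filter_subset_filter_mem]
      refine hS.card_filter_subset_four ?_
      rw [card_insert_of_notMem, cA1]
      simp only [mem_insert, mem_singleton]
      rintro (rfl | rfl | rfl)
      exacts [h1K hb.1, hinfK hb.1, hb.2 rfl])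
  rw [hS.card_filter_subset_two cA] at n35
  rw [hS.card_filter_subset_three cA1] at n7
  have cB : #(K₀ \ {p0}) = 7 := by
    rw [card_sdiff_of_subset (by simpa using h0K), hS.2.1 _ hK₀S, card_singleton]
  rw [cB] at n35 n7
  have := card_filter_add_card_filter_not
    (s := {L ∈ {L ∈ S | {pinf, p0} ⊆ L} | #(L ∩ K₀) = 4}) (fun L => p1 ∈ L)
  have e1 : {L ∈ {L ∈ {L ∈ S | {pinf, p0} ⊆ L} | #(L ∩ K₀) = 4} | p1 ∈ L}
      = {L ∈ {L ∈ S | {p1, pinf, p0} ⊆ L} | #(L ∩ K₀) = 4} := by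
    ext L
    simp only [mem_filter, insert_subset_iff]
    tauto
  have e2 : {L ∈ {L ∈ {L ∈ S | {pinf, p0} ⊆ L} | #(L ∩ K₀) = 4} | ¬ p1 ∈ L} =
      {K ∈ S | pinf ∈ K ∧ p0 ∈ K ∧ p1 ∉ K ∧ #(K ∩ K₀) = 4} := by
    ext L
    simp only [mem_filter, insert_subset_iff, singleton_subset_iff]
    tauto
  rw [e1, e2] at this
  omega

/-- `16` octads meet the octad `K` exactly in two given points. -/
theorem card_filter_inter_eq_pair (hS : IsSteinerSystem_5_8_24 S) {pinf p0 : Ω}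
    (hinf0 : pinf ≠ p0)
    {K : Finset Ω} (hK : K ∈ S) (hiK : pinf ∈ K) (h0 : p0 ∈ K) :
    #{L ∈ {L ∈ S | {pinf, p0} ⊆ L}.erase K | #(L ∩ K) = 2} = 16 := by
  have cA : #({pinf, p0} : Finset Ω) = 2 := card_pair hinf0
  have hsubK : {pinf, p0} ⊆ K := by simp [insert_subset_iff, hiK, h0]
  have cC : #(K \ {pinf, p0}) = 6 := by
    rw [card_sdiff_of_subset hsubK, hS.2.1 _ hK, cA]
  have n16 := hS.card_filter_card_inter_eq hK (P := {L ∈ S | {pinf, p0} ⊆ L}.erase K) (m := 20)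
    (B := K \ {pinf, p0}) (c := 2) ((erase_subset _ _).trans (filter_subset _ _))
    (notMem_erase _ _) (by norm_num) (by norm_num)
    (fun L hL => by
      rw [mem_erase, mem_filter] at hL
      rw [card_inter_eq_card_inter_sdiff_add hsubK hL.2.2, cA])
    (fun b hb => by
      rw [mem_sdiff] at hb
      rw [filter_erase, card_erase_of_mem (by simp [hK, hsubK, hb.1]), card_filter_subset_filter_mem,
        hS.card_filter_subset_three (by rw [card_insert_of_notMem hb.2, cA])])
  rw [card_erase_of_mem (by simp [hK, hsubK]), hS.card_filter_subset_two cA, cC] at n16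
  omega

/-- `6` octads through a point `b ∉ K` meet the octad `K` exactly in two given points. -/
theorem card_filter_inter_eq_pair_mem (hS : IsSteinerSystem_5_8_24 S) {pinf p0 : Ω}
    (hinf0 : pinf ≠ p0)
    {K : Finset Ω} (hK : K ∈ S) (hiK : pinf ∈ K) (h0 : p0 ∈ K) {b : Ω} (hb : b ∉ K) :
    #{L ∈ {L ∈ {L ∈ S | {pinf, p0} ⊆ L}.erase K | #(L ∩ K) = 2} | b ∈ L} = 6 := by
  have cA : #({pinf, p0} : Finset Ω) = 2 := card_pair hinf0
  have hsubK : {pinf, p0} ⊆ K := by simp [insert_subset_iff, hiK, h0]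
  have cC : #(K \ {pinf, p0}) = 6 := by
    rw [card_sdiff_of_subset hsubK, hS.2.1 _ hK, cA]
  have hbA : b ∉ ({pinf, p0} : Finset Ω) := fun h => hb (hsubK h)
  have n := hS.card_filter_card_inter_eq hK (P := {L ∈ S | insert b {pinf, p0} ⊆ L}) (m := 5)
    (B := K \ {pinf, p0}) (c := 2) (filter_subset _ _) (by simp [insert_subset_iff, hb])
    (by norm_num) (by norm_num)
    (fun L hL => by
      rw [mem_filter, insert_subset_iff] at hL
      rw [card_inter_eq_card_inter_sdiff_add hsubK hL.2.2, cA])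
    (fun x hx => by
      rw [mem_sdiff] at hx
      rw [card_filter_subset_filter_mem]
      refine hS.card_filter_subset_four ?_
      rw [card_insert_of_notMem, card_insert_of_notMem hbA, cA]
      rw [mem_insert, not_or]
      exact ⟨fun e => hb (e ▸ hx.1), hx.2⟩)
  rw [hS.card_filter_subset_three (by rw [card_insert_of_notMem hbA, cA]), cC] at n
  have e : {L ∈ {L ∈ {L ∈ S | {pinf, p0} ⊆ L}.erase K | #(L ∩ K) = 2} | b ∈ L}
      = {L ∈ {L ∈ S | insert b {pinf, p0} ⊆ L} | #(L ∩ K) = 2} := by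
    ext L
    simp only [mem_filter, mem_erase, insert_subset_iff (a := b)]
    constructor
    · tauto
    · rintro ⟨⟨hL, hbL, hs⟩, h2⟩
      exact ⟨⟨⟨fun e => hb (e ▸ hbL), hL, hs⟩, h2⟩, hbL⟩
  rw [e]
  omega

theorem card_filter_mem_mem_notMem_inter_eq_two (hS : IsSteinerSystem_5_8_24 S)
    {pinf p0 p1 : Ω} (h01 : p0 ≠ p1) (hinf0 : pinf ≠ p0) (hinf1 : pinf ≠ p1) {K₀ : Finset Ω}
    (hK₀S : K₀ ∈ S) (h0K : p0 ∈ K₀) (hinfK : pinf ∉ K₀)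
    {K : Finset Ω} (hK : K ∈ S) (hiK : pinf ∈ K) (h0 : p0 ∈ K) (h1 : p1 ∈ K)
    (hKK : #(K ∩ K₀) = 4) :
    #{K' ∈ {K ∈ S | pinf ∈ K ∧ p0 ∈ K ∧ p1 ∉ K ∧ #(K ∩ K₀) = 4} | #(K ∩ K') = 2} = 4 := by
  have cA : #({pinf, p0} : Finset Ω) = 2 := card_pair hinf0
  have hsubK : {pinf, p0} ⊆ K := by simp [insert_subset_iff, hiK, h0]
  have hinter : ∀ L : Finset Ω, {pinf, p0} ⊆ L → #(L ∩ K) = 2 → L ∩ K = {pinf, p0} :=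
    fun L hs h2 => (eq_of_subset_of_card_le (subset_inter hs hsubK) (by rw [h2, cA])).symm
  have hB : ∀ L ∈ {L ∈ {L ∈ S | {pinf, p0} ⊆ L}.erase K | #(L ∩ K) = 2},
      #(L ∩ K₀) = #(L ∩ (K₀ \ K)) + 1 := by
    intro L hL
    rw [mem_filter, mem_erase, mem_filter] at hL
    have hd : L ∩ K₀ ∩ K = {p0} := by
      rw [inter_right_comm, hinter L hL.1.2.2 hL.2, insert_inter_of_notMem hinfK,
        singleton_inter_of_mem h0K]
    rw [← card_sdiff_add_card_inter (L ∩ K₀) K, hd, inter_sdiff_assoc, card_singleton]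
  have hPS : {L ∈ {L ∈ S | {pinf, p0} ⊆ L}.erase K | #(L ∩ K) = 2} ⊆ S :=
    (filter_subset _ _).trans ((erase_subset _ _).trans (filter_subset _ _))
  have hK₀P : K₀ ∉ {L ∈ {L ∈ S | {pinf, p0} ⊆ L}.erase K | #(L ∩ K) = 2} := by
    simp [insert_subset_iff, hinfK]
  have n4 := hS.card_filter_card_inter_eq hK₀S hPS hK₀P one_pos one_le_two hB
    fun b hb => hS.card_filter_inter_eq_pair_mem hinf0 hK hiK h0 (mem_sdiff.1 hb).2
  have cD : #(K₀ \ K) = 4 := by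
    have := card_sdiff_add_card_inter K₀ K
    rw [inter_comm, hKK, hS.2.1 _ hK₀S] at this
    omega
  rw [cD, hS.card_filter_inter_eq_pair hinf0 hK hiK h0] at n4
  have e : {K' ∈ {K ∈ S | pinf ∈ K ∧ p0 ∈ K ∧ p1 ∉ K ∧ #(K ∩ K₀) = 4} | #(K ∩ K') = 2}
      = {L ∈ {L ∈ {L ∈ S | {pinf, p0} ⊆ L}.erase K | #(L ∩ K) = 2} | #(L ∩ K₀) = 4} := by
    ext L
    simp only [mem_filter, mem_erase, inter_comm K L]
    constructor
    · rintro ⟨⟨hL, hi, h0L, h1L, h4⟩, h2⟩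
      exact ⟨⟨⟨fun e => h1L (e ▸ h1), hL, by simp [insert_subset_iff, hi, h0L]⟩, h2⟩, h4⟩
    · rintro ⟨⟨⟨-, hL, hs⟩, h2⟩, h4⟩
      refine ⟨⟨hL, hs (by simp), hs (by simp), fun h1L => ?_, h4⟩, h2⟩
      have : p1 ∈ L ∩ K := mem_inter.2 ⟨h1L, h1⟩
      rw [hinter L hs h2] at this
      simp [hinf1.symm, h01.symm] at this
  rw [e]
  omega

end IsSteinerSystem_5_8_24

theorem A7_root_meets_four_nodal_classes {Ω : Type*} [Fintype Ω] [DecidableEq Ω]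
    (S : Finset (Finset Ω)) (hS : IsSteinerSystem_5_8_24 S)
    (pinf p0 p1 : Ω) (h01 : p0 ≠ p1) (hinf0 : pinf ≠ p0) (hinf1 : pinf ≠ p1)
    (K₀ : Finset Ω) (hK₀S : K₀ ∈ S)
    (h0K : p0 ∈ K₀) (hinfK : pinf ∉ K₀) (h1K : p1 ∉ K₀)
    (F : Finset (Finset Ω))
    (hF : F = S.filter fun K => pinf ∈ K ∧ p0 ∈ K ∧ p1 ∉ K ∧ (K ∩ K₀).card = 4) :
    ∀ K ∈ S, pinf ∈ K → p0 ∈ K → p1 ∈ K → (K ∩ K₀).card = 4 →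
      (F.filter fun K' => (K ∩ K').card = 2).card = 4 ∧
      (F.filter fun K' => (K ∩ K').card = 4).card = 24 := by
  intro K hK hiK h0 h1 hKK
  have hF28 : #F = 28 :=
    hF ▸ hS.card_filter_mem_mem_notMem h01 hinf0 hinf1 hK₀S h0K hinfK h1K
  have hF4 : #{K' ∈ F | #(K ∩ K') = 2} = 4 :=
    hF ▸ hS.card_filter_mem_mem_notMem_inter_eq_two h01 hinf0 hinf1 hK₀S h0K hinfK hK hiK h0 h1
      hKK
  refine ⟨hF4, ?_⟩
  have hsplit := card_filter_add_card_filter_not (s := F) (fun K' => #(K ∩ K') = 2)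
  have e : {K' ∈ F | ¬ #(K ∩ K') = 2} = {K' ∈ F | #(K ∩ K') = 4} := by
    refine filter_congr fun L hL => ?_
    rw [hF, mem_filter] at hL
    have hc := hS.card_inter_eq hK hL.1 (fun e => hL.2.2.2.1 (e ▸ h1))
    have hp : 0 < #(L ∩ K) := card_pos.2 ⟨pinf, mem_inter.2 ⟨hL.2.1, hiK⟩⟩
    rw [inter_comm]
    omega
  rw [e] at hsplit
  omega
end

section
/- Let Ω be a 24-element set, let ∞, 0, 1 ∈ Ω be distinct points, and let K₀ ⊆ Ω be an 8-element subset with 0 ∈ K₀ and ∞ ∉ K₀, 1 ∉ K₀. In the rational quadratic space V = ℚ × ℚ × ℚ^Ω with bilinear form ⟨(m,n,λ),(m',n',λ')⟩ = mn' + m'n − (1/8)·Σ_{i∈Ω} λᵢλ'ᵢ, let y, z, x, p, q, t be as in the paper (the Leech roots of Y = 4ν₀ + ν_Ω, Z = 0, X = 4ν_∞ + ν_Ω, P = 2ν_{K₀}, Q = 4ν_∞ + 4ν₀, T = ν_Ω − 4ν₁), let w = (1,0,0) and set w'' = −3y − 5z − 6x − 6p − 5q − 3t. Then ⟨w'', s⟩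 = 1 = ⟨w, s⟩ for every s ∈ {y, z, x, p, q, t}; consequently w' := w − w'' is orthogonal to the span of {y, z, x, p, q, t} and satisfies ⟨w', w'⟩ = 28. -/
/-- The bilinear form on `ℚ × ℚ × ℚ^Ω` underlying `II₁,₂₅ = U ⊕ Λ`:
`⟨(m,n,λ),(m',n',λ')⟩ = mn' + m'n − (1/8)·Σᵢ λᵢλ'ᵢ`. -/
def bform {Ω : Type*} [Fintype Ω] (v w : ℚ × ℚ × (Ω → ℚ)) : ℚ :=
  v.1 * w.2.1 + w.1 * v.2.1 - (∑ i, v.2.2 i * w.2.2 i) / 8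

/-- Indicator vector `ν_α` of a subset `α ⊆ Ω`. -/
def ind {Ω : Type*} [DecidableEq Ω] (α : Finset Ω) : Ω → ℚ :=
  fun i => if i ∈ α then 1 else 0

/-- The six vectors `y, z, x, p, q, t` of the paper, i.e. the Leech roots of
`Y = 4ν₀ + ν_Ω`, `Z = 0`, `X = 4ν_∞ + ν_Ω`, `P = 2ν_{K₀}`, `Q = 4ν_∞ + 4ν₀`,
`T = ν_Ω − 4ν₁`. -/
def a6Roots {Ω : Type*} [Fintype Ω] [DecidableEq Ω]
    (pinf p0 p1 : Ω) (K₀ : Finset Ω) : Fin 6 → ℚ × ℚ × (Ω → ℚ) :=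
  ![ (2, 1, fun i => 4 * ind {p0} i + 1),
     (-1, 1, fun _ => 0),
     (2, 1, fun i => 4 * ind {pinf} i + 1),
     (1, 1, fun i => 2 * ind K₀ i),
     (1, 1, fun i => 4 * ind {pinf} i + 4 * ind {p0} i),
     (1, 1, fun i => 1 - 4 * ind {p1} i) ]

section bform

variable {Ω : Type*} [Fintype Ω]

theorem bform_comm (u v : ℚ × ℚ × (Ω → ℚ)) : bform u v = bform v u := by
  simp only [bform, mul_comm (u.2.2 _)]
  ring

theorem bform_add_left (u v s : ℚ × ℚ × (Ω → ℚ)) :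
    bform (u + v) s = bform u s + bform v s := by
  simp only [bform, Prod.fst_add, Prod.snd_add, Pi.add_apply, add_mul, Finset.sum_add_distrib]
  ring

theorem bform_smul_left (c : ℚ) (u s : ℚ × ℚ × (Ω → ℚ)) :
    bform (c • u) s = c * bform u s := by
  simp only [bform, Prod.smul_fst, Prod.smul_snd, Pi.smul_apply, smul_eq_mul, mul_assoc,
    ← Finset.mul_sum]
  ring

theorem bform_sub_left (u v s : ℚ × ℚ × (Ω → ℚ)) :
    bform (u - v) s = bform u s - bform v s := by
  rw [sub_eq_add_neg, ← neg_one_smul ℚ v, bform_add_left, bform_smul_left]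
  ring

theorem bform_add_right (u v s : ℚ × ℚ × (Ω → ℚ)) :
    bform u (v + s) = bform u v + bform u s := by
  rw [bform_comm, bform_add_left, bform_comm v, bform_comm s]

theorem bform_smul_right (c : ℚ) (u s : ℚ × ℚ × (Ω → ℚ)) :
    bform u (c • s) = c * bform u s := by
  rw [bform_comm, bform_smul_left, bform_comm]

theorem bform_eq_zero_of_mem_span {u : ℚ × ℚ × (Ω → ℚ)} {S : Set (ℚ × ℚ × (Ω → ℚ))}
    (h : ∀ s ∈ S, bform u s = 0) {s : ℚ × ℚ × (Ω → ℚ)} (hs : s ∈ Submodule.span ℚ S) :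
    bform u s = 0 := by
  induction hs using Submodule.span_induction with
  | mem s hs => exact h s hs
  | zero => simp [bform]
  | add a b _ _ ha hb => rw [bform_add_right, ha, hb, add_zero]
  | smul c a _ ha => rw [bform_smul_right, ha, mul_zero]

end bform

/-- The Gram matrix of `a6Roots` is the negative of the Cartan matrix of type `A₆`. -/
theorem bform_a6Roots {Ω : Type*} [Fintype Ω] [DecidableEq Ω]
    (hΩ : Fintype.card Ω = 24) {pinf p0 p1 : Ω} (h01 : p0 ≠ p1) (hinf0 : pinf ≠ p0)
    (hinf1 : pinf ≠ p1) {K₀ : Finset Ω} (hK₀card : K₀.card = 8)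
    (h0K : p0 ∈ K₀) (hinfK : pinf ∉ K₀) (h1K : p1 ∉ K₀) (i j : Fin 6) :
    bform (a6Roots pinf p0 p1 K₀ i) (a6Roots pinf p0 p1 K₀ j) =
      if i = j then -2 else if i.val + 1 = j.val ∨ j.val + 1 = i.val then 1 else 0 := by
  fin_cases i <;> fin_cases j <;>
    simp [a6Roots, bform, ind, mul_add, add_mul, mul_sub, sub_mul, Finset.sum_add_distrib,
      Finset.sum_sub_distrib, hΩ, hK₀card, h0K, hinfK, h1K,
      h01, h01.symm, hinf0, hinf0.symm, hinf1, hinf1.symm] <;>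
    norm_num

/-- The Weyl vector `(1, 0, 0)` pairs to `1` with each of the six Leech roots. -/
theorem bform_weyl_a6Roots {Ω : Type*} [Fintype Ω] [DecidableEq Ω]
    (pinf p0 p1 : Ω) (K₀ : Finset Ω) (i : Fin 6) :
    bform (1, 0, 0) (a6Roots pinf p0 p1 K₀ i) = 1 := by
  fin_cases i <;> simp [a6Roots, bform]

/-- With `w = (1,0,0)` and `w'' = −3y − 5z − 6x − 6p − 5q − 3t`, the vectors `w''`
and `w` pair to `1` with each of `y,z,x,p,q,t`; hence `w' = w − w''` is orthogonal
to the span of `{y,z,x,p,q,t}` and `⟨w',w'⟩ = 28`. -/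
theorem weyl_vector_projection {Ω : Type*} [Fintype Ω] [DecidableEq Ω]
    (hΩ : Fintype.card Ω = 24)
    (pinf p0 p1 : Ω) (h01 : p0 ≠ p1) (hinf0 : pinf ≠ p0) (hinf1 : pinf ≠ p1)
    (K₀ : Finset Ω) (hK₀card : K₀.card = 8)
    (h0K : p0 ∈ K₀) (hinfK : pinf ∉ K₀) (h1K : p1 ∉ K₀)
    (v : Fin 6 → ℚ × ℚ × (Ω → ℚ)) (hv : v = a6Roots pinf p0 p1 K₀)
    (w : ℚ × ℚ × (Ω → ℚ)) (hw : w = (1, 0, 0))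
    (w'' : ℚ × ℚ × (Ω → ℚ))
    (hw'' : w'' = (-3 : ℚ) • v 0 + (-5 : ℚ) • v 1 + (-6 : ℚ) • v 2 +
      (-6 : ℚ) • v 3 + (-5 : ℚ) • v 4 + (-3 : ℚ) • v 5) :
    (∀ i : Fin 6, bform w'' (v i) = 1 ∧ bform w (v i) = 1) ∧
    (∀ u ∈ Submodule.span ℚ (Set.range v), bform (w - w'') u = 0) ∧
    bform (w - w'') (w - w'') = 28 := by
  have gram := bform_a6Roots hΩ h01 hinf0 hinf1 hK₀card h0K hinfK h1K
  have hwv : ∀ i, bform w (v i) = 1 := by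
    subst hv hw
    exact bform_weyl_a6Roots pinf p0 p1 K₀
  have hvw : ∀ i, bform (v i) w = 1 := fun i ↦ by rw [bform_comm, hwv]
  have hw''v : ∀ i, bform w'' (v i) = 1 := by
    intro i
    simp only [hw'', hv, bform_add_left, bform_smul_left, gram]
    fin_cases i <;> norm_num [Fin.ext_iff]
  have horth : ∀ i, bform (w - w'') (v i) = 0 := fun i ↦ by
    rw [bform_sub_left, hwv, hw''v, sub_self]
  refine ⟨fun i ↦ ⟨hw''v i, hwv i⟩, fun u hu ↦ bform_eq_zero_of_mem_span ?_ hu, ?_⟩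
  · rintro _ ⟨i, rfl⟩
    exact horth i
  · have hw''w : bform w'' w = -28 := by
      rw [hw'']
      simp only [bform_add_left, bform_smul_left, hvw]
      norm_num
    have hw''0 : bform (w - w'') w'' = 0 := by
      nth_rewrite 2 [hw'']
      simp only [bform_add_right, bform_smul_right, horth]
      norm_num
    have hww : bform w w = 0 := by simp [hw, bform]
    rw [bform_comm, bform_sub_left, bform_comm w'', hw''0, bform_comm, bform_sub_left, hww, hw''w]
    norm_num
end
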